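/- arXiv:2602.10773 — 3 statements merged into one kernel-verified Lean document; each statement's English description precedes it below -/
import Mathlib

section
/- For every T > 0, C > 0 and p > 0 there exists a constant K > 0 such that the following holds: for every integer N ≥ 1, setting h = T/N, and for all sequences of nonnegative real numbers (Z_n)_{n≥0} and (Z'_n)_{n≥0} satisfying, for every n ≤ N, both Z_n ≤ C·(h·Σ_{k=0}^{n-1} Z_k + h·Σ_{k=0}^{n-1} Z'_k + h^p) and Z'_n ≤ C·(Z_n + h·Σ_{k=0}^{n-1} Z_k + h·Σ_{k=0}^{n-1} Z'_k + h^p), one has Z_N ≤ K·h^p. (That is, Z_N = O(h^p) as h → 0, uniformly over all such sequences.) -/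
open Finset

/-- Two-sequence discrete Gronwall inequality: the accumulated sums grow at most geometrically. -/
lemma accumulated_sums_le_geometric {C h a : ℝ} (hC : 0 ≤ C) (hh : 0 ≤ h) {N : ℕ} {Z Z' : ℕ → ℝ}
    (hZ : ∀ n < N, Z n ≤ C * (h * ∑ k ∈ range n, Z k + h * ∑ k ∈ range n, Z' k + a))
    (hZ' : ∀ n < N, Z' n ≤ C * (Z n + h * ∑ k ∈ range n, Z k + h * ∑ k ∈ range n, Z' k + a)) :
    ∀ n ≤ N, h * ∑ k ∈ range n, Z k + h * ∑ k ∈ range n, Z' k + a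
      ≤ (1 + h * (C + C * (C + 1))) ^ n * a := by
  intro n
  induction n with
  | zero => simp
  | succ n ih =>
    intro hn
    set A := h * ∑ k ∈ range n, Z k + h * ∑ k ∈ range n, Z' k + a with hA
    have hZn : Z n ≤ C * A := hZ n hn
    have hZn' : Z' n ≤ C * (C + 1) * A := by
      calc Z' n ≤ C * (Z n + A) := by
            have := hZ' n hn
            rwa [add_assoc, add_assoc, ← add_assoc (h * _), ← hA] at this
        _ ≤ C * (C * A + A) := by gcongr
        _ = C * (C + 1) * A := by ring
    rw [sum_range_succ, sum_range_succ]
    calc h * (∑ k ∈ range n, Z k + Z n) + h * (∑ k ∈ range n, Z' k + Z' n) + a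
        = A + h * (Z n + Z' n) := by rw [hA]; ring
      _ ≤ A + h * (C * A + C * (C + 1) * A) := by gcongr
      _ = (1 + h * (C + C * (C + 1))) * A := by ring
      _ ≤ (1 + h * (C + C * (C + 1))) * ((1 + h * (C + C * (C + 1))) ^ n * a) := by
          gcongr
          exact ih (by omega)
      _ = (1 + h * (C + C * (C + 1))) ^ (n + 1) * a := by ring

/-- Discrete Gronwall-type lemma (Proposition 3): for every `T > 0`, `C > 0`, `p > 0`
there is `K > 0` such that for every `N ≥ 1`, with `h = T / N`, any nonnegative
sequences `Z`, `Z'` satisfying the two recursive bounds up to index `N` satisfy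
`Z N ≤ K * h ^ p`. -/
theorem stochastic_trbdf2_discrete_gronwall
    (T C p : ℝ) (hT : 0 < T) (hC : 0 < C) (hp : 0 < p) :
    ∃ K > 0, ∀ N : ℕ, 1 ≤ N →
      ∀ Z Z' : ℕ → ℝ,
        (∀ n, 0 ≤ Z n) → (∀ n, 0 ≤ Z' n) →
        (∀ n ≤ N, Z n ≤ C * ((T / N) * ∑ k ∈ range n, Z k
            + (T / N) * ∑ k ∈ range n, Z' k + (T / N) ^ p)) →
        (∀ n ≤ N, Z' n ≤ C * (Z n + (T / N) * ∑ k ∈ range n, Z k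
            + (T / N) * ∑ k ∈ range n, Z' k + (T / N) ^ p)) →
        Z N ≤ K * (T / N) ^ p := by
  refine ⟨C * Real.exp (T * (C + C * (C + 1))), by positivity, ?_⟩
  intro N hN Z Z' _ _ hZ hZ'
  have hN0 : (N : ℝ) ≠ 0 := by positivity
  have hgrowth : (1 + T / N * (C + C * (C + 1))) ^ N ≤ Real.exp (T * (C + C * (C + 1))) := by
    calc (1 + T / N * (C + C * (C + 1))) ^ N
        ≤ Real.exp (T / N * (C + C * (C + 1))) ^ N := by
          gcongr
          rw [add_comm]
          exact Real.add_one_le_exp _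
      _ = Real.exp (T * (C + C * (C + 1))) := by
          rw [← Real.exp_nat_mul]
          congr 1
          field_simp
  calc Z N ≤ C * ((T / N) * ∑ k ∈ range N, Z k
            + (T / N) * ∑ k ∈ range N, Z' k + (T / N) ^ p) := hZ N le_rfl
    _ ≤ C * ((1 + T / N * (C + C * (C + 1))) ^ N * (T / N) ^ p) := by
        gcongr
        exact accumulated_sums_le_geometric hC.le (by positivity)
          (fun n hn => hZ n hn.le) (fun n hn => hZ' n hn.le) N le_rfl
    _ ≤ C * (Real.exp (T * (C + C * (C + 1))) * (T / N) ^ p) := by gcongr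
    _ = C * Real.exp (T * (C + C * (C + 1))) * (T / N) ^ p := by ring
end

section
/- Let d ∈ ℕ, let a : ℝ^d → ℝ^d be continuous and satisfy the one-sided Lipschitz condition ⟨a(x) − a(y), x − y⟩ ≤ C·‖x − y‖² for all x, y ∈ ℝ^d, where C ≥ 0, and let h > 0 satisfy 2hC < 1. Then for every y ∈ ℝ^d there exists a unique x ∈ ℝ^d such that x − h·a(x) = y. -/
open RealInnerProductSpace

open Set Matrix in
/-- A real square matrix with entrywise nonnegative symmetric part maps some point of the standard
simplex into the nonnegative orthant. -/
theorem Matrix.exists_mem_stdSimplex_mulVec_nonneg {ι : Type*} [Fintype ι] [Nonempty ι]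
    (A : Matrix ι ι ℝ) (hA : ∀ i j, 0 ≤ A i j + A j i) :
    ∃ w ∈ stdSimplex ℝ ι, 0 ≤ A *ᵥ w := by
  classical
  by_contra! hcon
  have hdisj : Disjoint (A.mulVecLin '' stdSimplex ℝ ι) (Ici 0) := by
    rw [Set.disjoint_left]
    rintro _ ⟨w, hw, rfl⟩ h
    exact hcon w hw h
  obtain ⟨f, u, v, hfu, huv, hfv⟩ := geometric_hahn_banach_compact_closed
    ((convex_stdSimplex ℝ ι).linear_image A.mulVecLin)
    ((isCompact_stdSimplex ℝ ι).image A.mulVecLin.continuous_of_finiteDimensional)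
    (convex_Ici (0 : ι → ℝ)) isClosed_Ici hdisj
  have hv : v < 0 := by simpa using hfv 0 self_mem_Ici
  have hneg : ∀ w ∈ stdSimplex ℝ ι, f (A *ᵥ w) < 0 := fun w hw =>
    (hfu _ ⟨w, hw, rfl⟩).trans (huv.trans hv)
  set μ : ι → ℝ := fun i => f (Pi.single i 1) with hμ
  have hf : ∀ w : ι → ℝ, f w = ∑ i, w i * μ i := fun w => by
    conv_lhs => rw [pi_eq_sum_univ' w]
    simp [hμ]
  have hμ0 : ∀ i, 0 ≤ μ i := fun i => by
    by_contra! hi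
    have h1 := hfv ((v / μ i) • Pi.single i 1)
      (mem_Ici.2 <| smul_nonneg (div_nonneg_of_nonpos hv.le hi.le)
        (Pi.single_nonneg.2 zero_le_one))
    rw [map_smul, smul_eq_mul, div_mul_cancel₀ _ hi.ne] at h1
    exact lt_irrefl _ h1
  have hS : 0 < ∑ i, μ i := by
    refine (Finset.sum_nonneg fun i _ => hμ0 i).lt_of_ne' fun h0 => ?_
    have hz := (Finset.sum_eq_zero_iff_of_nonneg fun i _ => hμ0 i).1 h0
    have h1 := hneg _ (single_mem_stdSimplex ℝ (Classical.arbitrary ι))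
    rw [hf, Finset.sum_eq_zero fun i hi => by rw [hz i hi, mul_zero]] at h1
    exact lt_irrefl _ h1
  have hlt := hneg ((∑ i, μ i)⁻¹ • μ)
    ⟨fun i => mul_nonneg (inv_nonneg.2 hS.le) (hμ0 i), by
      simp [← Finset.mul_sum, hS.ne']⟩
  rw [mulVec_smul, map_smul, smul_eq_mul, hf] at hlt
  have hsum : 2 * ∑ i, (A *ᵥ μ) i * μ i = ∑ i, ∑ j, (A i j + A j i) * (μ i * μ j) := by
    have h1 : ∑ i, (A *ᵥ μ) i * μ i = ∑ i, ∑ j, A i j * (μ i * μ j) := by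
      simp only [mulVec, dotProduct, Finset.sum_mul]
      exact Finset.sum_congr rfl fun i _ => Finset.sum_congr rfl fun j _ => by ring
    have h2 : ∑ i, ∑ j, A i j * (μ i * μ j) = ∑ i, ∑ j, A j i * (μ i * μ j) := by
      rw [Finset.sum_comm]
      exact Finset.sum_congr rfl fun i _ => Finset.sum_congr rfl fun j _ => by ring
    simp only [add_mul, Finset.sum_add_distrib]
    rw [← h2, h1, two_mul]
  have hnn : 0 ≤ ∑ i, ∑ j, (A i j + A j i) * (μ i * μ j) :=
    Finset.sum_nonneg fun i _ => Finset.sum_nonneg fun j _ =>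
      mul_nonneg (hA i j) (mul_nonneg (hμ0 i) (hμ0 j))
  exact hlt.not_ge (mul_nonneg (inv_nonneg.2 hS.le) (by linarith))

section Monotone

variable {E : Type*} [NormedAddCommGroup E] [InnerProductSpace ℝ E]

/-- A monotone map admits a solution of the Minty variational inequality on every nonempty compact
convex set. -/
theorem IsCompact.exists_forall_inner_nonneg_of_monotone {K : Set E} (hK : IsCompact K)
    (hconv : Convex ℝ K) (hne : K.Nonempty) {F : E → E}
    (hF : ∀ x ∈ K, ∀ y ∈ K, 0 ≤ ⟪F x - F y, x - y⟫) :
    ∃ x ∈ K, ∀ y ∈ K, 0 ≤ ⟪F y, y - x⟫ := by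
  have hclosed : ∀ y : K, IsClosed {x : E | 0 ≤ ⟪F y, (y : E) - x⟫} := fun y =>
    isClosed_le continuous_const (by fun_prop)
  obtain ⟨x, hxK, hx⟩ := hK.inter_iInter_nonempty _ hclosed fun s => by
    rcases s.eq_empty_or_nonempty with rfl | hs
    · simpa using hne
    have : Nonempty s := hs.to_subtype
    obtain ⟨w, hw, hAw⟩ := Matrix.exists_mem_stdSimplex_mulVec_nonneg
      (Matrix.of fun i j : s => ⟪F i, (i : E) - j⟫) fun i j => by
        have h := hF i i.1.2 j j.1.2
        rw [inner_sub_left, ← neg_sub (j : E) (i : E), inner_neg_right, inner_neg_right] at h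
        rw [Matrix.of_apply, Matrix.of_apply, ← neg_sub (j : E) (i : E), inner_neg_right]
        linarith
    refine ⟨∑ j, w j • ((j : K) : E),
      hconv.sum_mem (fun j _ => hw.1 j) hw.2 fun j _ => j.1.2, Set.mem_iInter₂.2 fun y hy => ?_⟩
    have h := hAw ⟨y, hy⟩
    have hsub : ((y : K) : E) - ∑ j, w j • ((j : K) : E) = ∑ j, w j • ((y : E) - (j : K)) := by
      simp only [smul_sub, Finset.sum_sub_distrib, ← Finset.sum_smul, hw.2, one_smul]
    rw [Set.mem_ofPred_eq, hsub, inner_sum]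
    simpa [Matrix.mulVec, dotProduct, inner_smul_right, mul_comm] using h
  exact ⟨x, hxK, fun y hy => Set.mem_iInter.1 hx ⟨y, hy⟩⟩

/-- A solution of the Minty variational inequality for a continuous map on a convex set also solves
the Stampacchia variational inequality. -/
theorem Convex.inner_nonneg_of_forall_inner_nonneg {K : Set E} (hconv : Convex ℝ K) {F : E → E}
    (hF : Continuous F) {x : E} (hx : x ∈ K) (h : ∀ y ∈ K, 0 ≤ ⟪F y, y - x⟫) {z : E}
    (hz : z ∈ K) : 0 ≤ ⟪F x, z - x⟫ := by
  have hlim : Filter.Tendsto (fun t : ℝ => ⟪F (x + t • (z - x)), z - x⟫)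
      (nhdsWithin 0 (Set.Ioi 0)) (nhds ⟪F x, z - x⟫) := by
    have hc : Continuous fun t : ℝ => ⟪F (x + t • (z - x)), z - x⟫ := by fun_prop
    simpa using (hc.tendsto 0).mono_left nhdsWithin_le_nhds
  refine ge_of_tendsto hlim ?_
  filter_upwards [Ioo_mem_nhdsGT (zero_lt_one (α := ℝ))] with t ht
  have h1 := h _ (hconv.add_smul_sub_mem hx hz ⟨ht.1.le, ht.2.le⟩)
  rw [add_sub_cancel_left, inner_smul_right] at h1
  exact nonneg_of_mul_nonneg_right h1 ht.1

/-- A continuous strongly monotone map on a finite-dimensional real inner product space is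
bijective. -/
theorem Continuous.bijective_of_stronglyMonotone [FiniteDimensional ℝ E] {F : E → E}
    (hF : Continuous F) {m : ℝ} (hm : 0 < m)
    (hmono : ∀ x y, m * ‖x - y‖ ^ 2 ≤ ⟪F x - F y, x - y⟫) : Function.Bijective F := by
  refine ⟨fun x y hxy => ?_, fun y => ?_⟩
  · have h := hmono x y
    rw [hxy, sub_self, inner_zero_left] at h
    have h2 : ‖x - y‖ ^ 2 ≤ 0 := nonpos_of_mul_nonpos_right h hm
    simpa [sub_eq_zero] using h2.antisymm (sq_nonneg _)
  · set R := ‖F 0 - y‖ / m + 1 with hR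
    have hRpos : 0 < R := by positivity
    have hconv := convex_closedBall (0 : E) R
    obtain ⟨x, hxK, hx⟩ := (isCompact_closedBall (0 : E) R).exists_forall_inner_nonneg_of_monotone
      hconv ⟨0, by simpa using hRpos.le⟩ (F := fun x => F x - y) fun x _ z _ => by
        rw [sub_sub_sub_cancel_right]
        exact (by positivity : 0 ≤ m * ‖x - z‖ ^ 2).trans (hmono x z)
    have hvar : ∀ z ∈ Metric.closedBall (0 : E) R, 0 ≤ ⟪F x - y, z - x⟫ := fun z hz =>
      hconv.inner_nonneg_of_forall_inner_nonneg (hF.sub continuous_const) hxK hx hz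
    have hxR : ‖x‖ < R := by
      have h0 := hvar 0 (by simpa using hRpos.le)
      have h1 := hmono x 0
      have h2 := abs_le.1 (abs_real_inner_le_norm (F 0 - y) x)
      rw [zero_sub, inner_neg_right] at h0
      rw [sub_zero, ← sub_sub_sub_cancel_right _ _ y, inner_sub_left] at h1
      have h3 : ‖x‖ * (m * ‖x‖) ≤ ‖x‖ * ‖F 0 - y‖ := by nlinarith
      rcases (norm_nonneg x).eq_or_lt with h4 | h4
      · rwa [← h4]
      · have h5 : ‖x‖ ≤ ‖F 0 - y‖ / m := by
          rw [le_div_iff₀' hm]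
          exact le_of_mul_le_mul_left h3 h4
        linarith
    have hlim : Filter.Tendsto (fun t : ℝ => ‖x - t • (F x - y)‖)
        (nhdsWithin 0 (Set.Ioi 0)) (nhds ‖x‖) := by
      have hc : Continuous fun t : ℝ => ‖x - t • (F x - y)‖ := by fun_prop
      simpa using (hc.tendsto 0).mono_left nhdsWithin_le_nhds
    obtain ⟨t, htR, ht⟩ := ((hlim.eventually_lt_const hxR).and self_mem_nhdsWithin).exists
    have h := hvar (x - t • (F x - y)) (by simpa using htR.le)
    rw [sub_sub_cancel_left, inner_neg_right, inner_smul_right, real_inner_self_eq_norm_sq] at h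
    have h2 : ‖F x - y‖ ^ 2 ≤ 0 := nonpos_of_mul_nonpos_right (neg_nonneg.1 h) ht
    exact ⟨x, by simpa [sub_eq_zero] using h2.antisymm (sq_nonneg _)⟩

end Monotone

/-- Existence and uniqueness for the implicit stages of the stochastic TR-BDF2 scheme:
if `a : ℝ^d → ℝ^d` is continuous and one-sided Lipschitz with constant `C ≥ 0`, and
`h > 0` satisfies `2hC < 1`, then for every `y` there is a unique `x` with
`x - h • a x = y`. -/
theorem stochastic_trbdf2_implicit_existence_uniqueness
    (d : ℕ) (a : EuclideanSpace ℝ (Fin d) → EuclideanSpace ℝ (Fin d))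
    (ha : Continuous a) (C : ℝ) (hC : 0 ≤ C)
    (hlip : ∀ x y : EuclideanSpace ℝ (Fin d), ⟪a x - a y, x - y⟫ ≤ C * ‖x - y‖ ^ 2)
    (h : ℝ) (hh : 0 < h) (hhC : 2 * h * C < 1) :
    ∀ y : EuclideanSpace ℝ (Fin d), ∃! x : EuclideanSpace ℝ (Fin d),
      x - h • a x = y := by
  refine (Continuous.bijective_of_stronglyMonotone (F := fun x => x - h • a x) (by fun_prop)
    (m := 1 - h * C) (by linarith) fun x y => ?_).existsUnique
  have hsub : x - h • a x - (y - h • a y) = (x - y) - h • (a x - a y) := by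
    rw [smul_sub]; abel
  rw [hsub, inner_sub_left, inner_smul_left, real_inner_self_eq_norm_sq]
  have := mul_le_mul_of_nonneg_left (hlip x y) hh.le
  simp only [conj_trivial]
  linarith
end

section
/- Let γ ∈ (0,1) be real, and set γ₂ = (1−γ)/(2−γ) and γ₃ = 1/(γ(2−γ)). Let z, σ, λ, Y_n, Y_{n+γ}, Y_{n+1}, ΔW₁, ΔW₂, I₁, I₂ be complex numbers with 1 − (1/2)zγ ≠ 0 and 1 − zγ₂ ≠ 0. Suppose Y_{n+γ} = Y_n + (1/2)(Y_n + Y_{n+γ})·zγ + ΔW₁·σ·(1 − (1/2)zγ) + I₁·σλ, and Y_{n+1} = γ₃·Y_{n+γ} + (1−γ₃)·Y_n + Y_{n+1}·zγ₂ + ΔW₁·σ·(1 − zγ)·(1−γ₃) + I₁·σλ·(1−γ₃) + ΔW₂·σ·(1 − zγ₂) + I₂·σλ. Then the denominators (γ−1)z + (2−γ) and γ(1−γ)z² + (γ²−2)z + 2(2−γ) are nonzero, and Y_{n+1} = G(z)·Y_n + V_n + V_{n+γ}, where G(z) = ((1 + (1−γ)²)z + 2(2−γ)) / (γ(1−γ)z²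 + (γ²−2)z + 2(2−γ)), V_n = ΔW₁·σ·((1−γ)²z + (2−γ)) / ((γ−1)z + (2−γ)) + I₁·σλ·((1−γ)²z + 2(2−γ)) / (γ(1−γ)z² + (γ²−2)z + 2(2−γ)), and V_{n+γ} = ΔW₂·σ + I₂·σλ·(2−γ) / ((γ−1)z + (2−γ)). -/
/-- Algebraic elimination in the A-stability proof of the stochastic TR-BDF2 scheme:
from the two coupled stage equations, one obtains the one-step recursion
`Y_{n+1} = G(z) Y_n + V_n + V_{n+γ}`, the relevant denominators being nonzero. -/
theorem stochastic_trbdf2_one_step_recursion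
    (γ γ₂ γ₃ : ℝ) (hγ : γ ∈ Set.Ioo (0 : ℝ) 1)
    (hγ₂ : γ₂ = (1 - γ) / (2 - γ)) (hγ₃ : γ₃ = 1 / (γ * (2 - γ)))
    (z σ lam Yn Ynγ Yn1 ΔW₁ ΔW₂ I₁ I₂ : ℂ)
    (hden1 : 1 - (1 / 2) * z * (γ : ℂ) ≠ 0)
    (hden2 : 1 - z * (γ₂ : ℂ) ≠ 0)
    (hstage1 : Ynγ = Yn + (1 / 2) * (Yn + Ynγ) * z * (γ : ℂ)
        + ΔW₁ * σ * (1 - (1 / 2) * z * (γ : ℂ)) + I₁ * σ * lam)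
    (hstage2 : Yn1 = (γ₃ : ℂ) * Ynγ + (1 - (γ₃ : ℂ)) * Yn + Yn1 * z * (γ₂ : ℂ)
        + ΔW₁ * σ * (1 - z * (γ : ℂ)) * (1 - (γ₃ : ℂ))
        + I₁ * σ * lam * (1 - (γ₃ : ℂ))
        + ΔW₂ * σ * (1 - z * (γ₂ : ℂ)) + I₂ * σ * lam) :
    ((γ : ℂ) - 1) * z + (2 - (γ : ℂ)) ≠ 0 ∧
    (γ : ℂ) * (1 - (γ : ℂ)) * z ^ 2 + ((γ : ℂ) ^ 2 - 2) * z + 2 * (2 - (γ : ℂ)) ≠ 0 ∧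
    Yn1 = ((1 + (1 - (γ : ℂ)) ^ 2) * z + 2 * (2 - (γ : ℂ))) /
        ((γ : ℂ) * (1 - (γ : ℂ)) * z ^ 2 + ((γ : ℂ) ^ 2 - 2) * z + 2 * (2 - (γ : ℂ))) * Yn
      + (ΔW₁ * σ * (((1 - (γ : ℂ)) ^ 2 * z + (2 - (γ : ℂ))) /
          (((γ : ℂ) - 1) * z + (2 - (γ : ℂ))))
        + I₁ * σ * lam * (((1 - (γ : ℂ)) ^ 2 * z + 2 * (2 - (γ : ℂ))) /
          ((γ : ℂ) * (1 - (γ : ℂ)) * z ^ 2 + ((γ : ℂ) ^ 2 - 2) * z + 2 * (2 - (γ : ℂ)))))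
      + (ΔW₂ * σ + I₂ * σ * lam * ((2 - (γ : ℂ)) /
          (((γ : ℂ) - 1) * z + (2 - (γ : ℂ))))) := by
  obtain ⟨hγ_pos, hγ_lt⟩ := hγ
  have hg : (γ : ℂ) ≠ 0 := by exact_mod_cast hγ_pos.ne'
  have hg2 : 2 - (γ : ℂ) ≠ 0 := by
    have h : (2 - γ : ℝ) ≠ 0 := by linarith
    exact_mod_cast h
  have h₂ : (γ₂ : ℂ) * (2 - (γ : ℂ)) = 1 - γ := by
    rw [hγ₂]
    push_cast
    exact div_mul_cancel₀ _ hg2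
  have h₃ : (γ₃ : ℂ) * ((γ : ℂ) * (2 - (γ : ℂ))) = 1 := by
    rw [hγ₃]
    push_cast
    exact one_div_mul_cancel (mul_ne_zero hg hg2)
  clear hγ₂ hγ₃ hγ_pos hγ_lt
  generalize (γ : ℂ) = g at *
  generalize (γ₂ : ℂ) = g₂ at *
  generalize (γ₃ : ℂ) = g₃ at *
  have hA : (g - 1) * z + (2 - g) ≠ 0 := by
    have h : (g - 1) * z + (2 - g) = (2 - g) * (1 - z * g₂) := by
      linear_combination z * h₂
    rw [h]
    exact mul_ne_zero hg2 hden2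
  have hB : 2 - z * g ≠ 0 := by
    intro h
    exact hden1 (by linear_combination h / 2)
  have hD : g * (1 - g) * z ^ 2 + (g ^ 2 - 2) * z + 2 * (2 - g)
      = (2 - z * g) * ((g - 1) * z + (2 - g)) := by ring
  rw [hD]
  refine ⟨hA, mul_ne_zero hB hA, ?_⟩
  have hY : Ynγ = ((2 + z * g) * Yn + ΔW₁ * σ * (2 - z * g) + 2 * (I₁ * σ * lam))
      / (2 - z * g) := by
    rw [eq_div_iff hB]
    linear_combination 2 * hstage1
  have hY1 : Yn1 * ((g - 1) * z + (2 - g)) * g = Ynγ + (g * (2 - g) - 1) * Yn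
      + ΔW₁ * σ * (1 - z * g) * (g * (2 - g) - 1) + I₁ * σ * lam * (g * (2 - g) - 1)
      + g * ΔW₂ * σ * ((g - 1) * z + (2 - g)) + g * (2 - g) * (I₂ * σ * lam) := by
    linear_combination g * (2 - g) * hstage2 + g * z * (Yn1 - ΔW₂ * σ) * h₂
      + (Ynγ - Yn - ΔW₁ * σ * (1 - z * g) - I₁ * σ * lam) * h₃
  rw [hY] at hY1
  apply mul_right_cancel₀ (mul_ne_zero hA hg)
  rw [← mul_assoc, hY1]
  generalize hA_eq : (g - 1) * z + (2 - g) = A at *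
  field_simp
  rw [← hA_eq]
  ring
end
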